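/- For all integers n and k with 1 ≤ k ≤ n-1, the maximum number of edges of an n-vertex graph that is 𝓛_k-free equals max{ h_2(n,k,0), h_2(n,k,⌊(k-1)/2⌋) }. -/

import Mathlib

open SimpleGraph

/-- The degree of a vertex `v` in a graph `G` (as the cardinality of its neighbor set). -/
noncomputable def degN {V : Type*} (G : SimpleGraph V) (v : V) : ℕ :=
  (G.neighborSet v).ncard

/-- A linear forest: an acyclic graph all of whose vertices have degree at most `2`,
i.e. a forest whose connected components are paths and isolated vertices. -/
def IsLinearForest {V : Type*} (H : SimpleGraph V) : Prop :=
  H.IsAcyclic ∧ ∀ v, degN H v ≤ 2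

/-- `G` is `𝓛ₖ`-free: it contains no linear forest with exactly `k` edges as a subgraph. -/
def LinearForestFree {V : Type*} (k : ℕ) (G : SimpleGraph V) : Prop :=
  ∀ H : SimpleGraph V, H ≤ G → IsLinearForest H → H.edgeSet.ncard ≠ k

/-- `Nr r G` is the number of `r`-cliques of `G`. -/
noncomputable def Nr {V : Type*} (r : ℕ) (G : SimpleGraph V) : ℕ :=
  {s : Finset V | G.IsNClique r s}.ncard

/-- `hr r n k a = C(k-a, r) + (n-k+a) * C(a, r-1)` (as an integer). -/
def hr (r n k a : ℕ) : ℤ :=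
  (Nat.choose (k - a) r : ℤ) + ((n : ℤ) - (k : ℤ) + (a : ℤ)) * (Nat.choose a (r - 1) : ℤ)

/-- The graph `H(n,k,a)`: vertices `0,…,a-1` form the set `A`, vertices `a,…,k-a-1` form
the set `B`, the remaining `n-k+a` vertices form the set `C`; the edges are all edges inside
`A ∪ B` together with all edges between `A` and `C`. -/
def HGraph (n k a : ℕ) : SimpleGraph (Fin n) :=
  SimpleGraph.fromRel (fun u v => (u : ℕ) < a ∨ ((u : ℕ) < k - a ∧ (v : ℕ) < k - a))

/-- `H⁺(n,k,a)`: the graph `H(n,k,a)` with one extra edge inside `C`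
(between the first two vertices of `C`). -/
def HplusGraph (n k a : ℕ) : SimpleGraph (Fin n) :=
  SimpleGraph.fromRel (fun u v => (u : ℕ) < a ∨ ((u : ℕ) < k - a ∧ (v : ℕ) < k - a)
    ∨ ((u : ℕ) = k - a ∧ (v : ℕ) = k - a + 1))

/-- `H⁺⁺(n,k,a)`: the graph `H(n,k,a)` with two extra independent edges inside `C`. -/
def HplusplusGraph (n k a : ℕ) : SimpleGraph (Fin n) :=
  SimpleGraph.fromRel (fun u v => (u : ℕ) < a ∨ ((u : ℕ) < k - a ∧ (v : ℕ) < k - a)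
    ∨ ((u : ℕ) = k - a ∧ (v : ℕ) = k - a + 1)
    ∨ ((u : ℕ) = k - a + 2 ∧ (v : ℕ) = k - a + 3))

/-- `G` is isomorphic to a subgraph of `H`. -/
def IsoSubgraph {V W : Type*} (G : SimpleGraph V) (H : SimpleGraph W) : Prop :=
  ∃ f : V ↪ W, ∀ u v, G.Adj u v → H.Adj (f u) (f v)


/-- The sum of `R x y` over all pairs of consecutive entries `x, y` of a list. -/
def pairSum {V : Type*} (R : V → V → ℕ) : List V → ℕ
  | [] => 0
  | [_] => 0
  | x :: y :: l => R x y + pairSum R (y :: l)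

section pairSum

variable {V : Type*} {R S : V → V → ℕ}

lemma pairSum_append (p q : List V) (x y : V) :
    pairSum R ((p ++ [x]) ++ (y :: q)) = pairSum R (p ++ [x]) + R x y + pairSum R (y :: q) := by
  induction p with
  | nil => simp [pairSum]
  | cons a p ih =>
    cases p with
    | nil => simp [pairSum]; ring
    | cons b p => simp only [List.cons_append, pairSum] at ih ⊢; rw [ih]; ring

lemma pairSum_reverse (hR : ∀ x y, R x y = R y x) (l : List V) :
    pairSum R l.reverse = pairSum R l := by
  induction l with
  | nil => rfl
  | cons a l ih =>
    cases l with
    | nil => rfl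
    | cons b l =>
      have h := pairSum_append (R := R) l.reverse [] b a
      rw [← List.reverse_cons, ih] at h
      rw [List.reverse_cons, h, hR b a]
      simp only [pairSum]
      ring

lemma pairSum_mono {l : List V} (h : ∀ p x y q, l = p ++ x :: y :: q → R x y ≤ S x y) :
    pairSum R l ≤ pairSum S l := by
  induction l with
  | nil => rfl
  | cons a l ih =>
    cases l with
    | nil => rfl
    | cons b l =>
      have h₁ := h [] a b l rfl
      have h₂ := ih fun p x y q e => h (a :: p) x y q (by rw [e, List.cons_append])
      simp only [pairSum]
      omega

lemma pairSum_add (l : List V) :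
    pairSum (fun x y => R x y + S x y) l = pairSum R l + pairSum S l := by
  induction l with
  | nil => rfl
  | cons a l ih =>
    cases l with
    | nil => rfl
    | cons b l => simp only [pairSum, ih]; ring

lemma pairSum_snd (f : V → ℕ) (x : V) (l : List V) :
    pairSum (fun _ y => f y) (x :: l) = (l.map f).sum := by
  induction l generalizing x with
  | nil => rfl
  | cons b l ih => simp [pairSum, ih b]

lemma pairSum_fst (f : V → ℕ) (l : List V) (x : V) :
    pairSum (fun y _ => f y) (l ++ [x]) = (l.map f).sum := by
  induction l with
  | nil => rfl
  | cons a l ih =>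
    cases l with
    | nil => simp [pairSum]
    | cons b l => simp only [List.cons_append, pairSum] at ih ⊢; rw [ih]; simp

end pairSum

open Classical in
/-- The indicator of adjacency in `G`. -/
noncomputable def adjInd {V : Type*} (G : SimpleGraph V) (x y : V) : ℕ :=
  if G.Adj x y then 1 else 0

section rotation

variable {V : Type*} {G : SimpleGraph V}

lemma adjInd_comm (x y : V) : adjInd G x y = adjInd G y x := by
  classical
  unfold adjInd
  split_ifs with h₁ h₂ h₂
  exacts [rfl, absurd h₁.symm h₂, absurd h₂.symm h₁, rfl]

lemma adjInd_le_one (x y : V) : adjInd G x y ≤ 1 := by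
  unfold adjInd; split_ifs <;> simp

lemma adjInd_of_adj {x y : V} (h : G.Adj x y) : adjInd G x y = 1 := by
  simp [adjInd, h]

lemma adjInd_of_not_adj {x y : V} (h : ¬ G.Adj x y) : adjInd G x y = 0 := by
  simp [adjInd, h]

lemma adjInd_mono {H : SimpleGraph V} (h : G ≤ H) (x y : V) : adjInd G x y ≤ adjInd H x y := by
  by_cases hxy : G.Adj x y
  · rw [adjInd_of_adj hxy, adjInd_of_adj (h hxy)]
  · simp [adjInd_of_not_adj hxy]

lemma exists_cons_eq_append_singleton (y : V) (q : List V) : ∃ q' z, y :: q = q' ++ [z] :=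
  ⟨_, _, (List.dropLast_append_getLast (List.cons_ne_nil y q)).symm⟩

lemma exists_append_singleton_eq_cons (p : List V) (x : V) : ∃ h p', p ++ [x] = h :: p' := by
  cases p with
  | nil => exact ⟨x, [], rfl⟩
  | cons a p => exact ⟨a, p ++ [x], rfl⟩

lemma exists_consecutive_not_adj {l : List V} (h : pairSum (adjInd G) l + 1 < l.length) :
    ∃ p x y q, l = p ++ x :: y :: q ∧ ¬ G.Adj x y := by
  by_contra! hc
  have h₁ : pairSum (fun _ _ => 1) l ≤ pairSum (adjInd G) l :=
    pairSum_mono fun p x y q e => (adjInd_of_adj (hc p x y q e)).ge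
  cases l with
  | nil => simp at h
  | cons a l =>
    rw [pairSum_snd (fun _ => 1)] at h₁
    simp at h h₁
    omega

/-- If the ends of a sequence are adjacent, then rotating it at a pair of consecutive
nonadjacent vertices increases the number of consecutive adjacent pairs. -/
lemma exists_perm_pairSum_lt {h z : V} {t i : List V} (e : h :: t = i ++ [z]) (hzh : G.Adj z h)
    (hl : pairSum (adjInd G) (h :: t) + 1 < (h :: t).length) :
    ∃ b : List V, b.Perm (h :: t) ∧ pairSum (adjInd G) (h :: t) < pairSum (adjInd G) b := by
  obtain ⟨p, x, y, q, hs, hxy⟩ := exists_consecutive_not_adj hl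
  replace hs : h :: t = (p ++ [x]) ++ (y :: q) := by simpa using hs
  obtain ⟨q', z', hq⟩ := exists_cons_eq_append_singleton y q
  obtain ⟨h', p', hp⟩ := exists_append_singleton_eq_cons p x
  obtain rfl : h' = h := by
    rw [hp] at hs; simp at hs; exact hs.1.symm
  obtain rfl : z' = z := by
    rw [hq, e, ← List.append_assoc] at hs
    simpa using (List.append_inj' hs rfl).2.symm
  refine ⟨(y :: q) ++ (p ++ [x]), hs ▸ List.perm_append_comm, ?_⟩
  have h₁ := pairSum_append (R := adjInd G) p q x y
  have h₂ := pairSum_append (R := adjInd G) q' p' z' h'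
  rw [← hp, ← hq, adjInd_of_adj hzh] at h₂
  rw [adjInd_of_not_adj hxy] at h₁
  rw [hs]
  omega

/-- In a sequence `v, …, x, y, …, u` which is one short of having `k` consecutive adjacent pairs,
while no rearrangement has `k` of them, `v y` and `x u` are edges only if `x y` is. -/
lemma adjInd_add_le {k : ℕ} {m p q p' q' : List V} {v u x y : V}
    (hmax : ∀ l : List V, l.Perm m → pairSum (adjInd G) l < k)
    (hm : k ≤ pairSum (adjInd G) m + 1) (hlen : k < m.length)
    (e : m = (p ++ [x]) ++ (y :: q)) (hp : p ++ [x] = v :: p') (hq : y :: q = q' ++ [u]) :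
    adjInd G v y + adjInd G x u ≤ adjInd G x y := by
  have hprev : (p ++ [x]).reverse = p'.reverse ++ [v] := by rw [hp]; simp
  have hqrev : (y :: q).reverse = u :: q'.reverse := by rw [hq]; simp
  have h₀ := pairSum_append (R := adjInd G) p q x y
  have h₁ := pairSum_append (R := adjInd G) p'.reverse q v y
  rw [← hprev, pairSum_reverse adjInd_comm] at h₁
  have h₂ := pairSum_append (R := adjInd G) p q'.reverse x u
  rw [← hqrev, pairSum_reverse adjInd_comm] at h₂
  have perm₁ : ((p ++ [x]).reverse ++ (y :: q)).Perm m :=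
    e ▸ (List.reverse_perm _).append_right _
  have g₁ := hmax _ perm₁
  have g₂ := hmax _ (e ▸ (List.reverse_perm (y :: q)).append_left (p ++ [x]))
  rw [← e] at h₀
  have b₁ := adjInd_le_one (G := G) x y
  have b₂ := adjInd_le_one (G := G) v y
  have b₃ := adjInd_le_one (G := G) x u
  by_contra hcon
  have hxy : adjInd G x y = 1 := by omega
  have hvy : adjInd G v y = 1 := by omega
  have hxu : G.Adj x u := by
    by_contra h
    rw [adjInd_of_not_adj h] at hcon
    omega
  have e₃ : (p ++ [x]).reverse ++ (y :: q) = x :: (p.reverse ++ y :: q) := by simp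
  have e₄ : x :: (p.reverse ++ y :: q) = ((p ++ [x]).reverse ++ q') ++ [u] := by
    rw [← e₃, hq, List.append_assoc]
  have hlen' := perm₁.length_eq
  rw [e₃] at h₁ perm₁ hlen' g₁
  obtain ⟨b, hb, hlt⟩ := exists_perm_pairSum_lt e₄ hxu.symm (by omega)
  have := hmax b (hb.trans perm₁)
  omega

end rotation

section degree

variable {V : Type*} [Fintype V] {G : SimpleGraph V}

lemma degN_eq_sum (v : V) : degN G v = ∑ w, adjInd G v w := by
  classical
  rw [degN, Set.ncard_eq_toFinset_card']
  simp [adjInd, Finset.sum_boole]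

lemma degN_eq_list_sum {m : List V} (hm : m.Nodup) (hmem : ∀ w, w ∈ m) (v : V) :
    degN G v = (m.map (adjInd G v)).sum := by
  classical
  rw [degN_eq_sum, ← List.sum_toFinset _ hm]
  congr 1
  ext w
  simp [hmem w]

lemma degN_add_degN_lt {k : ℕ} {mid : List V} {v u : V} (hvu : ¬ G.Adj v u)
    (hnd : (v :: mid ++ [u]).Nodup) (hmem : ∀ w, w ∈ v :: mid ++ [u])
    (hmax : ∀ l : List V, l.Perm (v :: mid ++ [u]) → pairSum (adjInd G) l < k)
    (hm : k ≤ pairSum (adjInd G) (v :: mid ++ [u]) + 1)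
    (hlen : k < (v :: mid ++ [u]).length) : degN G v + degN G u < k := by
  have hle : pairSum (fun x y => adjInd G v y + adjInd G x u) (v :: mid ++ [u]) ≤
      pairSum (adjInd G) (v :: mid ++ [u]) := by
    refine pairSum_mono fun p x y q e => ?_
    replace e : v :: mid ++ [u] = (p ++ [x]) ++ (y :: q) := by simpa using e
    obtain ⟨q', z, hq⟩ := exists_cons_eq_append_singleton y q
    obtain ⟨h, p', hp⟩ := exists_append_singleton_eq_cons p x
    obtain rfl : h = v := by
      rw [hp] at e; simp at e; exact e.1.symm
    obtain rfl : z = u := by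
      rw [hq, ← List.append_assoc] at e
      simpa using (List.append_inj' e rfl).2.symm
    exact adjInd_add_le hmax hm hlen e hp hq
  have h₁ : pairSum (fun _ y => adjInd G v y) (v :: mid ++ [u]) = degN G v := by
    rw [List.cons_append, pairSum_snd, degN_eq_list_sum hnd hmem]
    simp [adjInd, hvu]
  have h₂ : pairSum (fun x _ => adjInd G x u) (v :: mid ++ [u]) = degN G u := by
    simp only [adjInd_comm (G := G) _ u]
    rw [pairSum_fst, degN_eq_list_sum hnd hmem]
    simp [adjInd]
  rw [pairSum_add, h₁, h₂] at hle
  have := hmax _ (List.Perm.refl _)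
  omega

/-- In a graph that is edge-maximal without a sequence of all vertices having `k` consecutive
adjacent pairs, the degrees of nonadjacent vertices add up to less than `k`. -/
lemma degN_add_degN_lt_of_maximal {k : ℕ} (hk : k < Fintype.card V)
    (hG : Maximal (fun G : SimpleGraph V => ∀ l : List V, l.Nodup → (∀ w, w ∈ l) →
      pairSum (adjInd G) l < k) G)
    {u v : V} (huv : u ≠ v) (hadj : ¬ G.Adj u v) : degN G u + degN G v < k := by
  classical
  have hlt : G < G ⊔ edge u v := by
    refine lt_of_le_of_ne le_sup_left fun h => hadj ?_
    rw [h]; simp [edge_adj, huv]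
  have hnot := hG.not_prop_of_gt hlt
  push Not at hnot
  obtain ⟨l, hnd, hmem, hl⟩ := hnot
  have hlG := hG.prop l hnd hmem
  have hsplit : ∃ p x y q, l = p ++ x :: y :: q ∧ s(x, y) = s(u, v) := by
    by_contra! hc
    refine (hl.trans (pairSum_mono fun p x y q e => ?_)).not_gt hlG
    have := hc p x y q e
    simp only [adjInd, sup_adj, edge_adj]
    split_ifs <;> grind
  obtain ⟨p, x, y, q, hs, hxy⟩ := hsplit
  replace hs : l = (p ++ [x]) ++ (y :: q) := by simpa using hs
  have hxy' : ¬ G.Adj x y := by rwa [← mem_edgeSet, hxy, mem_edgeSet]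
  have hdeg : degN G u + degN G v = degN G y + degN G x := by
    rcases Sym2.eq_iff.1 hxy with ⟨rfl, rfl⟩ | ⟨rfl, rfl⟩ <;> ring
  have hp : pairSum (adjInd (G ⊔ edge u v)) (p ++ [x]) ≤ pairSum (adjInd G) (p ++ [x]) := by
    refine pairSum_mono fun p' a b q' e => ?_
    have ha : y ≠ a := by
      rintro rfl; rw [hs, e] at hnd; simp [List.nodup_append] at hnd
    have hb : y ≠ b := by
      rintro rfl; rw [hs, e] at hnd; simp [List.nodup_append] at hnd
    simp only [adjInd, sup_adj, edge_adj]
    split_ifs <;> grind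
  have hq : pairSum (adjInd (G ⊔ edge u v)) (y :: q) ≤ pairSum (adjInd G) (y :: q) := by
    refine pairSum_mono fun p' a b q' e => ?_
    have ha : x ≠ a := by
      rintro rfl; rw [hs, e] at hnd; simp [List.nodup_append] at hnd
    have hb : x ≠ b := by
      rintro rfl; rw [hs, e] at hnd; simp [List.nodup_append] at hnd
    simp only [adjInd, sup_adj, edge_adj]
    split_ifs <;> grind
  have h₁ := pairSum_append (R := adjInd (G ⊔ edge u v)) p q x y
  have h₂ := adjInd_le_one (G := G ⊔ edge u v) x y
  rw [← hs] at h₁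
  have hm : k ≤ pairSum (adjInd G) (p ++ [x]) + pairSum (adjInd G) (y :: q) + 1 := by omega
  have hcomm : ((y :: q) ++ (p ++ [x])).Perm l := hs ▸ List.perm_append_comm
  have hlen : l.length = Fintype.card V := by
    rw [← List.toFinset_card_of_nodup hnd, Finset.card_eq_iff_eq_univ]
    ext w
    simp [hmem w]
  have e : (y :: q) ++ (p ++ [x]) = y :: (q ++ p) ++ [x] := by simp
  rw [hdeg]
  rw [e] at hcomm
  refine degN_add_degN_lt (mt (fun h => h.symm) hxy') (hcomm.nodup_iff.2 hnd)
    (fun w => hcomm.mem_iff.2 (hmem w))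
    (fun l' h => hG.prop l' ((h.trans hcomm).nodup_iff.2 hnd)
      fun w => (h.trans hcomm).mem_iff.2 (hmem w)) ?_ (by rw [hcomm.length_eq, hlen]; exact hk)
  rw [← e]
  obtain ⟨q', z, hq'⟩ := exists_cons_eq_append_singleton y q
  obtain ⟨h, p', hp'⟩ := exists_append_singleton_eq_cons p x
  have h₃ := pairSum_append (R := adjInd G) q' p' z h
  rw [← hp', ← hq'] at h₃
  omega

end degree

lemma degN_sup_edge_of_ne {V : Type*} {G : SimpleGraph V} {x y v : V} (hx : v ≠ x) (hy : v ≠ y) :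
    degN (G ⊔ edge y x) v = degN G v := by
  unfold degN
  congr 1
  ext w
  simp [edge_adj, hx, hy]

section linearForest

variable {V : Type*} [Finite V] {G : SimpleGraph V}

lemma degN_mono {H : SimpleGraph V} (h : H ≤ G) (v : V) : degN H v ≤ degN G v :=
  Set.ncard_le_ncard (fun _ hw => h hw) (Set.toFinite _)

lemma degN_sup_edge_le (x y v : V) : degN (G ⊔ edge y x) v ≤ degN G v + 1 := by
  classical
  have h : (G ⊔ edge y x).neighborSet v ⊆ insert (if v = y then x else y) (G.neighborSet v) := by
    intro w hw
    simp only [mem_neighborSet, sup_adj, edge_adj, Set.mem_insert_iff] at hw ⊢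
    grind
  exact (Set.ncard_le_ncard h (Set.toFinite _)).trans (Set.ncard_insert_le _ _)

/-- The edges of `G` between consecutive entries of a list form a linear forest. -/
lemma exists_isLinearForest_of_cons (l : List V) (x : V) (hnd : (x :: l).Nodup) :
    ∃ H ≤ G, IsLinearForest H ∧ degN H x ≤ 1 ∧ (∀ a b, H.Adj a b → a ∈ x :: l) ∧
      pairSum (adjInd G) (x :: l) ≤ H.edgeSet.ncard := by
  induction l generalizing x with
  | nil =>
    refine ⟨⊥, bot_le, ⟨isAcyclic_bot, fun v => ?_⟩, ?_, by simp, by simp [pairSum]⟩ <;>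
    simp [degN, neighborSet]
  | cons z l ih =>
    rename' x => y, z => x
    obtain ⟨H, hHG, ⟨hac, hdeg⟩, hx, hsupp, hcard⟩ := ih x hnd.of_cons
    have hy : y ∉ x :: l := (List.nodup_cons.1 hnd).1
    have hyx : y ≠ x := fun h => hy (h ▸ List.mem_cons_self)
    have hiso : ∀ b, ¬ H.Adj y b := fun b hb => hy (hsupp _ _ hb)
    have hdegy : degN H y = 0 := by
      simp [degN, neighborSet, hiso]
    by_cases hadj : G.Adj y x
    · refine ⟨H ⊔ edge y x, sup_le hHG ?_, ⟨hac.sup_edge_of_not_reachable ?_, fun v => ?_⟩,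
        ?_, ?_, ?_⟩
      · simpa [edge_le_iff] using Or.inr hadj
      · rintro ⟨w⟩
        cases w with
        | nil => exact hyx rfl
        | cons h _ => exact hiso _ h
      · have := degN_sup_edge_le (G := H) x y v
        by_cases h₁ : v = x
        · subst h₁; omega
        by_cases h₂ : v = y
        · subst h₂; omega
        rw [degN_sup_edge_of_ne h₁ h₂]
        exact hdeg v
      · have := degN_sup_edge_le (G := H) x y y
        omega
      · intro a b hab
        simp only [sup_adj, edge_adj] at hab
        have := hsupp a b
        grind
      · have hnew : s(y, x) ∉ H.edgeSet := hiso x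
        rw [edgeSet_sup, edgeSet_edge_of_ne hyx, Set.union_singleton,
          Set.ncard_insert_of_notMem hnew (Set.toFinite _)]
        simp only [pairSum, adjInd_of_adj hadj]
        omega
    · refine ⟨H, hHG, ⟨hac, hdeg⟩, by omega, fun a b hab => ?_, ?_⟩
      · exact List.mem_cons_of_mem _ (hsupp a b hab)
      · simpa [pairSum, adjInd_of_not_adj hadj] using hcard

lemma LinearForestFree.pairSum_lt {k : ℕ} (hk : 1 ≤ k) (hG : LinearForestFree k G) (l : List V)
    (hnd : l.Nodup) : pairSum (adjInd G) l < k := by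
  cases l with
  | nil => exact hk
  | cons x l =>
    by_contra! hle
    obtain ⟨H, hHG, ⟨hac, hdeg⟩, -, -, hcard⟩ := exists_isLinearForest_of_cons (G := G) l x hnd
    obtain ⟨E, hE, hEk⟩ := Set.exists_subset_card_eq (hle.trans hcard)
    have hEH : fromEdgeSet E ≤ H := by
      rw [← fromEdgeSet_edgeSet H]
      exact fromEdgeSet_mono hE
    refine hG (fromEdgeSet E) (hEH.trans hHG)
      ⟨hac.anti hEH, fun v => (degN_mono hEH v).trans (hdeg v)⟩ ?_
    rw [edgeSet_fromEdgeSet, ← hEk]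
    congr 1
    exact sdiff_eq_left.2 (Set.disjoint_left.2 fun e he => H.not_isDiag_of_mem_edgeSet (hE he))

end linearForest

section count

variable {V : Type*} [Fintype V] {G : SimpleGraph V}

/-- If every edge of `G` meets `S` or lies inside `T`, then the number of edges is at most the
degree sum over `S` plus the number of pairs in `T`. -/
lemma ncard_edgeSet_le (S T : Finset V)
    (h : ∀ x y, G.Adj x y → x ∈ S ∨ y ∈ S ∨ (x ∈ T ∧ y ∈ T)) :
    G.edgeSet.ncard ≤ ∑ v ∈ S, degN G v + T.card.choose 2 := by
  classical
  have hsub : G.edgeSet ⊆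
      ↑(S.biUnion (fun v => (G.neighborSet v).toFinset.image fun w => s(v, w)) ∪
        T.offDiag.image (fun p : V × V => s(p.1, p.2))) := by
    intro e
    induction e with | _ x y
    intro hxy
    rw [mem_edgeSet] at hxy
    simp only [Finset.coe_union, Set.mem_union, Finset.mem_coe, Finset.mem_biUnion,
      Finset.mem_image, Set.mem_toFinset, mem_neighborSet, Finset.mem_offDiag]
    rcases h x y hxy with hx | hy | ⟨hx, hy⟩
    · exact Or.inl ⟨x, hx, y, hxy, rfl⟩
    · exact Or.inl ⟨y, hy, x, hxy.symm, Sym2.eq_swap⟩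
    · exact Or.inr ⟨(x, y), ⟨hx, hy, hxy.ne⟩, rfl⟩
  refine (Set.ncard_le_ncard hsub (Set.toFinite _)).trans ?_
  rw [Set.ncard_coe_finset]
  refine (Finset.card_union_le _ _).trans (add_le_add ?_ ?_)
  · refine Finset.card_biUnion_le.trans (Finset.sum_le_sum fun v _ => ?_)
    rw [degN, Set.ncard_eq_toFinset_card']
    exact Finset.card_image_le
  · exact (Sym2.card_image_offDiag T).le

/-- If the degrees of nonadjacent vertices add up to less than `k`, then for some `i` with
`2 * i < k` the number of edges is at most `h₂(n, k, i)`. -/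
lemma exists_ncard_edgeSet_le_hr {k : ℕ} (hk : k < Fintype.card V) (hG : G ≠ ⊤)
    (hdeg : ∀ u v, u ≠ v → ¬ G.Adj u v → degN G u + degN G v < k) :
    ∃ i, 2 * i < k ∧ (G.edgeSet.ncard : ℤ) ≤ hr 2 (Fintype.card V) k i := by
  classical
  obtain ⟨a, b, hab, hnadj⟩ := ne_top_iff_exists_not_adj.1 hG
  obtain ⟨⟨u, v⟩, huv, hmax⟩ := Finset.exists_max_image
    (Finset.univ.filter fun p : V × V => p.1 ≠ p.2 ∧ ¬ G.Adj p.1 p.2)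
    (fun p => degN G p.1 + degN G p.2) ⟨(a, b), by simp [hab, hnadj]⟩
  simp only [Finset.mem_filter, Finset.mem_univ, true_and, Prod.forall, and_imp] at huv hmax
  wlog hle : degN G u ≤ degN G v generalizing u v
  · refine this v u ⟨huv.1.symm, fun h => huv.2 h.symm⟩ (fun x y h₁ h₂ => ?_) (by omega)
    rw [add_comm (degN G v)]
    exact hmax x y h₁ h₂
  have hlt := hdeg u v huv.1 huv.2
  set n := Fintype.card V with hn
  have hcard : (G.neighborSet v).toFinset.card = degN G v := by
    rw [degN, Set.ncard_eq_toFinset_card']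
  have hcompl := Finset.card_add_card_compl (insert v (G.neighborSet v).toFinset)
  rw [Finset.card_insert_of_notMem (by simp), hcard] at hcompl
  obtain ⟨S, hS, hScard⟩ := Finset.exists_subset_card_eq
    (s := (insert v (G.neighborSet v).toFinset)ᶜ) (n := n - k + degN G u) (by omega)
  have hSdeg : ∀ w ∈ S, degN G w ≤ degN G u := by
    intro w hw
    have := hS hw
    simp at this
    have := hmax w v this.1 fun h => this.2 h.symm
    omega
  have hSc : Sᶜ.card = k - degN G u := by
    rw [Finset.card_compl, hScard]; omega
  refine ⟨degN G u, by omega, ?_⟩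
  have h₁ := ncard_edgeSet_le (G := G) S Sᶜ fun x y _ => by
    simp only [Finset.mem_compl]; tauto
  have h₂ := Finset.sum_le_card_nsmul S _ _ hSdeg
  rw [hScard, smul_eq_mul] at h₂
  rw [hSc] at h₁
  have h₃ := h₁.trans (Nat.add_le_add_right h₂ _)
  zify [hk.le] at h₃
  simp only [hr, Nat.choose_one_right, Nat.add_one_sub_one]
  linarith

end count

lemma two_mul_hr {n k i : ℕ} (h : i ≤ k) :
    2 * hr 2 n k i = ((k : ℤ) - i) * (k - i - 1) + 2 * (n - k + i) * i := by
  obtain ⟨j, rfl⟩ := Nat.exists_eq_add_of_le h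
  have h₁ : (2 : ℤ) * (j.choose 2 : ℤ) = j * (j - 1) := by
    have := Nat.cast_choose_two ℚ j
    have h₂ : (2 : ℚ) * (j.choose 2 : ℚ) = j * (j - 1) := by rw [this]; ring
    exact_mod_cast h₂
  simp only [hr, Nat.choose_one_right, Nat.add_one_sub_one, Nat.add_sub_cancel_left]
  push_cast
  linear_combination h₁

lemma hr_le_max {n k i a : ℕ} (hia : i ≤ a) (hak : a ≤ k) :
    hr 2 n k i ≤ max (hr 2 n k 0) (hr 2 n k a) := by
  by_contra! h
  obtain ⟨h₁, h₂⟩ := max_lt_iff.1 h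
  have e₀ := two_mul_hr (n := n) (Nat.zero_le k)
  have e₁ := two_mul_hr (n := n) (hia.trans hak)
  have e₂ := two_mul_hr (n := n) hak
  push_cast at e₀
  have hia' : (i : ℤ) ≤ a := by exact_mod_cast hia
  have hi : (0 : ℤ) ≤ i := by positivity
  have g₁ : 0 < (i : ℤ) * (3 * i + (2 * n - 4 * k + 1)) := by linarith
  have g₂ := (pos_iff_pos_of_mul_pos g₁).1 (lt_of_le_of_ne hi fun h₀ => by simp [← h₀] at g₁)
  nlinarith

/-- An `𝓛ₖ`-free graph on `n > k` vertices has at most `max {h₂(n,k,0), h₂(n,k,⌊(k-1)/2⌋)}`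
edges. -/
lemma LinearForestFree.ncard_edgeSet_le {V : Type*} [Fintype V] {k : ℕ} {G : SimpleGraph V}
    (hk : 1 ≤ k) (hkn : k < Fintype.card V) (hG : LinearForestFree k G) :
    (G.edgeSet.ncard : ℤ) ≤
      max (hr 2 (Fintype.card V) k 0) (hr 2 (Fintype.card V) k ((k - 1) / 2)) := by
  classical
  obtain ⟨M, hGM, hM⟩ := Finite.exists_le_maximal
    (p := fun G : SimpleGraph V => ∀ l : List V, l.Nodup → (∀ w, w ∈ l) →
      pairSum (adjInd G) l < k) fun l hl _ => hG.pairSum_lt hk l hl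
  have htop : M ≠ ⊤ := by
    rintro rfl
    obtain ⟨p, x, y, q, hs, hxy⟩ := exists_consecutive_not_adj
      (G := (⊤ : SimpleGraph V)) (l := Finset.univ.toList) (by
        have := hM.prop Finset.univ.toList (Finset.nodup_toList _) (by simp)
        simp only [Finset.length_toList, Finset.card_univ]
        omega)
    have hnd := Finset.nodup_toList (Finset.univ : Finset V)
    obtain rfl : x = y := by simpa using hxy
    rw [hs] at hnd
    simp [List.nodup_append] at hnd
  obtain ⟨i, hi, hle⟩ := exists_ncard_edgeSet_le_hr hkn htop
    fun u v huv hadj => degN_add_degN_lt_of_maximal hkn hM huv hadj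
  calc (G.edgeSet.ncard : ℤ) ≤ M.edgeSet.ncard := by
        exact_mod_cast Set.ncard_le_ncard (edgeSet_subset_edgeSet.2 hGM) (Set.toFinite _)
    _ ≤ _ := hle
    _ ≤ _ := hr_le_max (by omega) (by omega)

section HGraph

variable {n k a : ℕ}

lemma card_filter_val_lt {m : ℕ} (h : m ≤ n) :
    (Finset.univ.filter fun v : Fin n => (v : ℕ) < m).card = m := by
  rw [Fin.card_filter_val_lt]; exact min_eq_right h

lemma hr_le_ncard_edgeSet_HGraph (hkn : k ≤ n) (ha : 2 * a ≤ k) :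
    hr 2 n k a ≤ (HGraph n k a).edgeSet.ncard := by
  set P : Finset (Fin n) := Finset.univ.filter fun v => (v : ℕ) < k - a with hP
  set A : Finset (Fin n) := Finset.univ.filter fun v => (v : ℕ) < a with hA
  have hPcard : P.card = k - a := card_filter_val_lt (by omega)
  have hAcard : A.card = a := card_filter_val_lt (by omega)
  have hdisj : Disjoint (P.offDiag.image fun p : Fin n × Fin n => s(p.1, p.2))
      ((A ×ˢ Pᶜ).image fun p : Fin n × Fin n => s(p.1, p.2)) := by
    rw [Finset.disjoint_left]
    simp only [Finset.mem_image, Finset.mem_offDiag, Finset.mem_product, Prod.exists,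
      Finset.mem_compl, not_exists]
    rintro _ ⟨x, y, ⟨hx, hy, -⟩, rfl⟩ z w ⟨⟨-, hw⟩, e⟩
    rcases Sym2.eq_iff.1 e with ⟨rfl, rfl⟩ | ⟨rfl, rfl⟩ <;> contradiction
  have hsub : (↑((P.offDiag.image fun p : Fin n × Fin n => s(p.1, p.2)) ∪
      ((A ×ˢ Pᶜ).image fun p : Fin n × Fin n => s(p.1, p.2))) : Set (Sym2 (Fin n))) ⊆
      (HGraph n k a).edgeSet := by
    intro e he
    simp only [Finset.coe_union, Set.mem_union, Finset.mem_coe, Finset.mem_image,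
      Finset.mem_offDiag, Finset.mem_product, Prod.exists, Finset.mem_compl] at he
    rcases he with ⟨x, y, ⟨hx, hy, hxy⟩, rfl⟩ | ⟨x, y, ⟨hx, hy⟩, rfl⟩
    · simp only [hP, Finset.mem_filter, Finset.mem_univ, true_and] at hx hy
      simp [HGraph, hxy, hx, hy]
    · simp only [hP, hA, Finset.mem_filter, Finset.mem_univ, true_and] at hx hy
      have hxy : x ≠ y := by rintro rfl; omega
      simp [HGraph, hxy, hx]
  have hinj : Set.InjOn (fun p : Fin n × Fin n => s(p.1, p.2)) ↑(A ×ˢ Pᶜ) := by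
    rintro ⟨x, y⟩ hxy ⟨z, w⟩ hzw e
    simp only [hP, hA, Finset.coe_product, Set.mem_prod, Finset.mem_coe, Finset.mem_filter,
      Finset.mem_univ, true_and, Finset.mem_compl] at hxy hzw
    rcases Sym2.eq_iff.1 e with ⟨rfl, rfl⟩ | ⟨rfl, rfl⟩
    · rfl
    · exact absurd (show (x : ℕ) < a from hxy.1) (by have : ¬ (x : ℕ) < k - a := hzw.2; omega)
  have hle := Set.ncard_le_ncard hsub (Set.toFinite _)
  rw [Set.ncard_coe_finset, Finset.card_union_of_disjoint hdisj,
    show (P.offDiag.image fun p : Fin n × Fin n => s(p.1, p.2)).card = _ from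
      Sym2.card_image_offDiag P, Finset.card_image_of_injOn hinj, Finset.card_product, Finset.card_compl, hPcard, hAcard,
    Fintype.card_fin] at hle
  have hcast : ((n - (k - a) : ℕ) : ℤ) = n - k + a := by omega
  zify at hle
  rw [hcast] at hle
  simp only [hr, Nat.choose_one_right, Nat.add_one_sub_one]
  linarith

lemma linearForestFree_HGraph (hk : 1 ≤ k) (hkn : k ≤ n) :
    LinearForestFree k (HGraph n k ((k - 1) / 2)) := by
  intro F hF hlin hcard
  set a := (k - 1) / 2 with ha
  have h := _root_.ncard_edgeSet_le (G := F) (Finset.univ.filter fun v : Fin n => (v : ℕ) < a)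
    ((Finset.univ.filter fun v : Fin n => (v : ℕ) < k - a) \
      Finset.univ.filter fun v : Fin n => (v : ℕ) < a) (by
      intro x y hxy
      have := hF hxy
      simp only [HGraph, fromRel_adj] at this
      simp only [Finset.mem_sdiff, Finset.mem_filter, Finset.mem_univ, true_and]
      omega)
  have hsum : ∑ v ∈ Finset.univ.filter (fun v : Fin n => (v : ℕ) < a), degN F v ≤ _ := Finset.sum_le_card_nsmul (Finset.univ.filter fun v : Fin n => (v : ℕ) < a) _ _
    fun v _ => hlin.2 v
  rw [card_filter_val_lt (by omega), smul_eq_mul] at hsum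
  rw [Finset.card_sdiff_of_subset (fun v => by simp; omega), card_filter_val_lt (by omega),
    card_filter_val_lt (by omega), hcard] at h
  have hka : k - a - a = 1 ∨ k - a - a = 2 := by omega
  rcases hka with e | e <;> rw [e] at h <;> simp at h <;> omega

lemma SimpleGraph.IsAcyclic.ncard_edgeSet_lt {V : Type*} [Fintype V] [Nonempty V]
    {F : SimpleGraph V} (hF : F.IsAcyclic) : F.edgeSet.ncard < Fintype.card V := by
  classical
  obtain ⟨T, hFT, -, hT⟩ := connected_top.exists_isTree_le_of_le_of_isAcyclic le_top hF
  have h₁ := hT.card_edgeFinset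
  have h₂ := Set.ncard_le_ncard (edgeSet_subset_edgeSet.2 hFT) (Set.toFinite _)
  rw [← coe_edgeFinset T, Set.ncard_coe_finset] at h₂
  omega

lemma linearForestFree_HGraph_zero (hk : 1 ≤ k) (hkn : k ≤ n) :
    LinearForestFree k (HGraph n k 0) := by
  intro F hF hlin hcard
  have : Nonempty (Fin k) := ⟨⟨0, hk⟩⟩
  have hlt := (hlin.1.of_comap (Fin.castLEEmb hkn)).ncard_edgeSet_lt
  have hsub : F.edgeSet ⊆
      Sym2.map (Fin.castLE hkn) '' (F.comap (Fin.castLEEmb hkn)).edgeSet := by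
    intro e
    induction e with | _ x y
    intro hxy
    have h := hF hxy
    simp only [HGraph, fromRel_adj] at h
    refine ⟨s(⟨x, by omega⟩, ⟨y, by omega⟩), ?_, rfl⟩
    simpa using hxy
  have h₁ := Set.ncard_le_ncard hsub (Set.toFinite _)
  have h₂ := Set.ncard_image_le (f := Sym2.map (Fin.castLE hkn))
    (Set.toFinite (F.comap (Fin.castLEEmb hkn)).edgeSet)
  rw [Fintype.card_fin] at hlt
  omega

end HGraph

/-- Ning–Wang. For `1 ≤ k ≤ n-1`, the maximum number of edges of an
`n`-vertex `𝓛ₖ`-free graph equals `max { h₂(n,k,0), h₂(n,k,⌊(k-1)/2⌋) }`. -/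
theorem statement0 (n k : ℕ) (hk : 1 ≤ k) (hkn : k ≤ n - 1) :
    IsGreatest {m : ℤ | ∃ G : SimpleGraph (Fin n),
        LinearForestFree k G ∧ (G.edgeSet.ncard : ℤ) = m}
      (max (hr 2 n k 0) (hr 2 n k ((k - 1) / 2))) := by
  have hkn' : k < n := by omega
  have hupper : ∀ G : SimpleGraph (Fin n), LinearForestFree k G →
      (G.edgeSet.ncard : ℤ) ≤ max (hr 2 n k 0) (hr 2 n k ((k - 1) / 2)) := by
    intro G hG
    simpa using hG.ncard_edgeSet_le hk (by simpa using hkn')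
  refine ⟨?_, fun m ⟨G, hG, hm⟩ => hm ▸ hupper G hG⟩
  rcases max_choice (hr 2 n k 0) (hr 2 n k ((k - 1) / 2)) with h | h
  · have hfree := linearForestFree_HGraph_zero hk hkn'.le
    refine ⟨HGraph n k 0, hfree, le_antisymm (hupper _ hfree) ?_⟩
    rw [h]
    exact hr_le_ncard_edgeSet_HGraph hkn'.le (by omega)
  · have hfree := linearForestFree_HGraph hk hkn'.le
    refine ⟨HGraph n k ((k - 1) / 2), hfree, le_antisymm (hupper _ hfree) ?_⟩
    rw [h]
    exact hr_le_ncard_edgeSet_HGraph hkn'.le (by omega)
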